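/- arXiv:1404.0551 — 4 statements merged into one kernel-verified Lean document; each statement's English description precedes it below -/
import Mathlib

section
/- For every natural number k and every real s, (2π)^{−1/2} ∫_ℝ H_k(x) e^{−x²/2} e^{−isx} dx = (−i)^k s^k e^{−s²/2}. -/
open MeasureTheory Real Filter

/-- Probabilist's Hermite polynomial `H_k(x)`. -/
noncomputable def hermiteFun (k : ℕ) (x : ℝ) : ℝ := Polynomial.aeval x (Polynomial.hermite k)

/-- A polynomial times the standard Gaussian is integrable. -/
theorem integrable_aeval_mul_exp_neg_sq_div_two (p : Polynomial ℤ) :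
    Integrable fun x : ℝ => Polynomial.aeval x p * Real.exp (-x ^ 2 / 2) := by
  induction p using Polynomial.induction_on' with
  | add p q hp hq => exact (hp.add hq).congr (.of_forall fun x => by simp [add_mul])
  | monomial n a =>
    have hn : (-1 : ℝ) < n := neg_one_lt_zero.trans_le n.cast_nonneg
    refine ((integrable_rpow_mul_exp_neg_mul_sq (b := 1 / 2) (by norm_num) hn).const_mul
      (a : ℝ)).congr (.of_forall fun x => ?_)
    simp only [Polynomial.aeval_monomial, Real.rpow_natCast, eq_intCast]
    rw [show -(1 / 2) * x ^ 2 = -x ^ 2 / 2 by ring, mul_assoc]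

theorem hasDerivAt_hermiteFun_mul_exp (k : ℕ) (x : ℝ) :
    HasDerivAt (fun x => hermiteFun k x * Real.exp (-x ^ 2 / 2))
      (-(hermiteFun (k + 1) x * Real.exp (-x ^ 2 / 2))) x := by
  have hg : HasDerivAt (fun x : ℝ => -x ^ 2 / 2) (-x) x :=
    ((hasDerivAt_pow 2 x).neg.div_const 2).congr_deriv (by simp; ring)
  refine (((Polynomial.hermite k).hasDerivAt_aeval x).mul hg.exp).congr_deriv ?_
  simp only [hermiteFun, Polynomial.hermite_succ, map_sub, map_mul, Polynomial.aeval_X]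
  ring

theorem integrable_hermiteFun_mul_exp_mul_cexp (k : ℕ) (s : ℝ) :
    Integrable fun x : ℝ => ((hermiteFun k x * Real.exp (-x ^ 2 / 2) : ℝ) : ℂ) *
      Complex.exp (-(Complex.I * s * x)) := by
  refine (integrable_aeval_mul_exp_neg_sq_div_two (Polynomial.hermite k)).ofReal.mul_bdd
    (c := 1) (by fun_prop) (.of_forall fun x => ?_)
  simp [Complex.norm_exp]

theorem integral_hermiteFun_succ_mul_exp_mul_cexp (k : ℕ) (s : ℝ) :
    ∫ x : ℝ, ((hermiteFun (k + 1) x * Real.exp (-x ^ 2 / 2) : ℝ) : ℂ) *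
        Complex.exp (-(Complex.I * s * x))
      = -Complex.I * s * ∫ x : ℝ, ((hermiteFun k x * Real.exp (-x ^ 2 / 2) : ℝ) : ℂ) *
        Complex.exp (-(Complex.I * s * x)) := by
  have hv (x : ℝ) : HasDerivAt (fun x : ℝ => Complex.exp (-(Complex.I * s * x)))
      (-Complex.I * s * Complex.exp (-(Complex.I * s * x))) x :=
    ((Complex.ofRealCLM.hasDerivAt (x := x)).const_mul (Complex.I * s)).neg.cexp.congr_deriv
      (by simp; ring)
  have hparts := integral_mul_deriv_eq_deriv_mul_of_integrable
    (fun x _ => (hasDerivAt_hermiteFun_mul_exp k x).ofReal_comp) (fun x _ => hv x)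
    (((integrable_hermiteFun_mul_exp_mul_cexp k s).const_mul (-Complex.I * s)).congr
      (.of_forall fun x => by simp only [Pi.mul_apply]; ring))
    ((integrable_hermiteFun_mul_exp_mul_cexp (k + 1) s).neg.congr
      (.of_forall fun x => by simp only [Pi.mul_apply, Pi.neg_apply, Complex.ofReal_neg]; ring))
    (integrable_hermiteFun_mul_exp_mul_cexp k s)
  simp only [Complex.ofReal_neg, neg_mul _ (Complex.exp _), integral_neg, neg_neg] at hparts
  rw [← integral_const_mul, ← hparts]
  congr 1 with x
  ring

theorem integral_hermiteFun_zero_mul_exp_mul_cexp (s : ℝ) :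
    ∫ x : ℝ, ((hermiteFun 0 x * Real.exp (-x ^ 2 / 2) : ℝ) : ℂ) *
        Complex.exp (-(Complex.I * s * x))
      = (Real.sqrt (2 * Real.pi) : ℂ) * Complex.exp (-(s : ℂ) ^ 2 / 2) := by
  have hconst : ((π : ℂ) / (1 / 2)) ^ (1 / 2 : ℂ) = (Real.sqrt (2 * π) : ℂ) := by
    rw [Real.sqrt_eq_rpow, Complex.ofReal_cpow (by positivity)]
    push_cast
    congr 1
    ring
  have h := fourierIntegral_gaussian (b := 1 / 2) (by norm_num) (-(s : ℂ))
  rw [hconst] at h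
  convert h using 2
  · ext x
    simp only [hermiteFun, Polynomial.hermite_zero, map_one, one_mul, Complex.ofReal_exp]
    rw [mul_comm]
    congr 2 <;> (push_cast; ring)
  · congr 1
    ring

/-- `(2π)^{-1/2} ∫ H_k(x) e^{-x²/2} e^{-isx} dx = (-i)^k s^k e^{-s²/2}`. -/
theorem fourier_hermite_gaussian (k : ℕ) (s : ℝ) :
    (Real.sqrt (2 * Real.pi) : ℂ)⁻¹ *
        ∫ x : ℝ, ((hermiteFun k x * Real.exp (-x ^ 2 / 2) : ℝ) : ℂ) *
          Complex.exp (-(Complex.I * s * x))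
      = (-Complex.I) ^ k * (s : ℂ) ^ k * Complex.exp (-(s : ℂ) ^ 2 / 2) := by
  induction k with
  | zero =>
    have hne : (Real.sqrt (2 * Real.pi) : ℂ) ≠ 0 :=
      Complex.ofReal_ne_zero.mpr (Real.sqrt_pos.mpr Real.two_pi_pos).ne'
    rw [integral_hermiteFun_zero_mul_exp_mul_cexp, inv_mul_cancel_left₀ hne]
    simp
  | succ k ih =>
    rw [integral_hermiteFun_succ_mul_exp_mul_cexp, mul_left_comm, ih]
    ring
end

section
/- For every real x ≥ 0, ∑_{k=1}^∞ (k/2) x^{k/2} / Γ(k/2 + 1) = √(x/π) + x e^x (1 + erf(√x)). -/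
open MeasureTheory Real Filter

/-- Gaussian error function `erf(z) = (2/√π) ∫_0^z e^{-t²} dt`. -/
noncomputable def erf (z : ℝ) : ℝ :=
  2 / Real.sqrt Real.pi * ∫ t in (0:ℝ)..z, Real.exp (-t ^ 2)

theorem integral_pow_two_mul_mul_exp_neg_sq (s : ℝ) (n : ℕ) :
    (n + 1 / 2 : ℝ) * ∫ t in (0:ℝ)..s, t ^ (2 * n) * exp (-t ^ 2)
      = s ^ (2 * n + 1) * exp (-s ^ 2) / 2
        + ∫ t in (0:ℝ)..s, t ^ (2 * (n + 1)) * exp (-t ^ 2) := by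
  have hderiv (t : ℝ) : HasDerivAt (fun t : ℝ => t ^ (2 * n + 1) * exp (-t ^ 2) / 2)
      ((n + 1 / 2 : ℝ) * (t ^ (2 * n) * exp (-t ^ 2))
        - t ^ (2 * (n + 1)) * exp (-t ^ 2)) t := by
    convert! ((hasDerivAt_pow (2 * n + 1) t).mul
      ((hasDerivAt_pow 2 t).neg.exp)).div_const 2 using 1
    simp only [Nat.add_sub_cancel, Pi.neg_apply]
    push_cast
    ring
  have hint (m : ℕ) :
      IntervalIntegrable (fun t : ℝ => t ^ m * exp (-t ^ 2)) volume 0 s :=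
    Continuous.intervalIntegrable (by fun_prop) _ _
  have key := intervalIntegral.integral_eq_sub_of_hasDerivAt (fun t _ => hderiv t)
    (((hint (2 * n)).const_mul _).sub (hint (2 * (n + 1))))
  rw [intervalIntegral.integral_sub ((hint (2 * n)).const_mul _) (hint (2 * (n + 1))),
    intervalIntegral.integral_const_mul] at key
  simp at key
  simp
  linarith

theorem exp_sq_mul_erf_eq_sum_add (s : ℝ) (N : ℕ) :
    exp (s ^ 2) * erf s = ∑ n ∈ Finset.range N, s ^ (2 * n + 1) / Gamma (n + 1 / 2 + 1)
      + 2 * exp (s ^ 2) * (∫ t in (0:ℝ)..s, t ^ (2 * N) * exp (-t ^ 2)) / Gamma (N + 1 / 2) := by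
  induction N with
  | zero =>
    have h := Real.Gamma_one_half_eq
    simp only [Finset.range_zero, Finset.sum_empty, Nat.cast_zero, zero_add, h, erf, mul_zero,
      pow_zero, one_mul]
    ring
  | succ N ih =>
    have hpos : (0 : ℝ) < N + 1 / 2 := by positivity
    have hG := Gamma_pos_of_pos hpos
    have hrec := integral_pow_two_mul_mul_exp_neg_sq s N
    have hexp : exp (s ^ 2) * exp (-s ^ 2) = 1 := by rw [← exp_add]; simp
    rw [ih, Finset.sum_range_succ, add_assoc]
    congr 1
    rw [show ((N + 1 : ℕ) : ℝ) + 1 / 2 = N + 1 / 2 + 1 by push_cast; ring,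
      Gamma_add_one hpos.ne', ← add_div, div_eq_div_iff hG.ne' (by positivity)]
    linear_combination 2 * exp (s ^ 2) * Gamma (N + 1 / 2) * hrec
      + Gamma (N + 1 / 2) * s ^ (2 * N + 1) * hexp

theorem factorial_mul_sqrt_pi_le_two_mul_Gamma (n : ℕ) :
    (n.factorial : ℝ) * √π ≤ 2 * Gamma (n + 1 + 1 / 2) := by
  induction n with
  | zero =>
    have h : Gamma (1 / 2 + 1) = 1 / 2 * √π := by
      rw [Gamma_add_one (by norm_num), Real.Gamma_one_half_eq]
    rw [show ((0 : ℕ) : ℝ) + 1 + 1 / 2 = 1 / 2 + 1 by norm_num, h]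
    simp
  | succ n ih =>
    have hpos : (0 : ℝ) < n + 1 + 1 / 2 := by positivity
    have hG := Gamma_pos_of_pos hpos
    rw [show ((n + 1 : ℕ) : ℝ) + 1 + 1 / 2 = n + 1 + 1 / 2 + 1 by push_cast; ring,
      Gamma_add_one hpos.ne', Nat.factorial_succ]
    push_cast
    have := mul_le_mul_of_nonneg_left ih (by positivity : (0 : ℝ) ≤ n + 1)
    linarith

theorem hasSum_exp_sq_mul_erf {s : ℝ} (hs : 0 ≤ s) :
    HasSum (fun n : ℕ => s ^ (2 * n + 1) / Gamma (n + 1 / 2 + 1)) (exp (s ^ 2) * erf s) := by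
  have hG (n : ℕ) : 0 < Gamma ((n : ℝ) + 1 / 2) := Gamma_pos_of_pos (by positivity)
  have hG' (n : ℕ) : 0 < Gamma ((n : ℝ) + 1 / 2 + 1) := Gamma_pos_of_pos (by positivity)
  rw [hasSum_iff_tendsto_nat_of_nonneg fun n => div_nonneg (by positivity) (hG' n).le]
  have hJ0 (n : ℕ) : 0 ≤ ∫ t in (0:ℝ)..s, t ^ (2 * n) * exp (-t ^ 2) :=
    intervalIntegral.integral_nonneg hs fun t ht => mul_nonneg (pow_nonneg ht.1 _) (exp_pos _).le
  have hJ (n : ℕ) : ∫ t in (0:ℝ)..s, t ^ (2 * n) * exp (-t ^ 2) ≤ s ^ (2 * n) * s := by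
    have := intervalIntegral.integral_mono_on (μ := volume) hs
      (f := fun t => t ^ (2 * n) * exp (-t ^ 2)) (g := fun _ => s ^ (2 * n))
      (Continuous.intervalIntegrable (by fun_prop) _ _) intervalIntegrable_const
      (fun t ht => by
        have h1 : t ^ (2 * n) ≤ s ^ (2 * n) := pow_le_pow_left₀ ht.1 ht.2 _
        have h2 : exp (-t ^ 2) ≤ 1 := exp_le_one_iff.2 (by nlinarith [sq_nonneg t])
        calc _ ≤ s ^ (2 * n) * 1 := mul_le_mul h1 h2 (exp_pos _).le (by positivity)
          _ = _ := mul_one _)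
    simpa [mul_comm] using this
  have hrem : Tendsto (fun N : ℕ => 2 * exp (s ^ 2) *
      (∫ t in (0:ℝ)..s, t ^ (2 * N) * exp (-t ^ 2)) / Gamma (N + 1 / 2)) atTop (nhds 0) := by
    rw [← tendsto_add_atTop_iff_nat 1]
    have hlim := (FloorSemiring.tendsto_pow_div_factorial_atTop (s ^ 2)).const_mul
      (4 * exp (s ^ 2) * s ^ 3 / √π)
    rw [mul_zero] at hlim
    refine squeeze_zero
      (fun n => div_nonneg (mul_nonneg (by positivity) (hJ0 _)) (hG _).le) (fun n => ?_) hlim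
    have hfac := factorial_mul_sqrt_pi_le_two_mul_Gamma n
    push_cast
    calc _ ≤ 2 * exp (s ^ 2) * (s ^ (2 * (n + 1)) * s) / (n.factorial * √π / 2) := by
          gcongr
          · exact hJ _
          · linarith
      _ = _ := by
          field_simp
          ring
  have := (tendsto_const_nhds (x := exp (s ^ 2) * erf s)).sub hrem
  rw [sub_zero] at this
  refine this.congr fun N => ?_
  rw [exp_sq_mul_erf_eq_sum_add s N]
  ring

theorem mul_rpow_div_Gamma_eq {x : ℝ} (hx : 0 ≤ x) (k : ℕ) :
    (((k : ℝ) + 1) / 2) * x ^ (((k : ℝ) + 1) / 2) / Gamma (((k : ℝ) + 1) / 2 + 1)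
      = √x ^ (k + 1) / Gamma (((k : ℝ) + 1) / 2) := by
  have hpos : (0 : ℝ) < (k + 1) / 2 := by positivity
  have hpow : x ^ (((k : ℝ) + 1) / 2) = √x ^ (k + 1) := by
    rw [sqrt_eq_rpow, ← rpow_natCast, ← rpow_mul hx]
    congr 1
    push_cast
    ring
  rw [Gamma_add_one hpos.ne', hpow, mul_div_mul_left _ _ hpos.ne']

/-- For `x ≥ 0`, `∑_{k=1}^∞ (k/2) x^{k/2} / Γ(k/2+1) = √(x/π) + x eˣ (1 + erf(√x))`. -/
theorem tsum_half_k_rpow_div_gamma (x : ℝ) (hx : 0 ≤ x) :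
    ∑' k : ℕ, (((k : ℝ) + 1) / 2) * x ^ (((k : ℝ) + 1) / 2) /
        Real.Gamma (((k : ℝ) + 1) / 2 + 1)
      = Real.sqrt (x / Real.pi) + x * Real.exp x * (1 + erf (Real.sqrt x)) := by
  simp_rw [mul_rpow_div_Gamma_eq hx]
  have hsq : √x ^ 2 = x := sq_sqrt hx
  have heven : HasSum (fun n : ℕ => √x ^ (2 * n + 1) / Gamma ((((2 * n : ℕ) : ℝ) + 1) / 2))
      (x * (exp x * erf √x) + √x / √π) := by
    have h := (hasSum_exp_sq_mul_erf (sqrt_nonneg x)).mul_left x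
    rw [hsq] at h
    refine (hasSum_nat_add_iff' 1).1 ?_
    convert! h using 1
    · ext n
      rw [← mul_div_assoc]
      congr 1
      · rw [show 2 * (n + 1) + 1 = 2 + (2 * n + 1) by ring, pow_add, hsq]
      · congr 1
        push_cast
        ring
    · have hG := Real.Gamma_one_half_eq
      simp [-one_div, hG]
  have hodd : HasSum
      (fun n : ℕ => √x ^ (2 * n + 1 + 1) / Gamma ((((2 * n + 1 : ℕ) : ℝ) + 1) / 2))
      (x * exp x) := by
    have h := (NormedSpace.expSeries_div_hasSum_exp x).mul_left x
    rw [← exp_eq_exp_ℝ] at h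
    convert! h using 1
    ext n
    rw [← mul_div_assoc, ← Gamma_nat_eq_factorial]
    congr 1
    · rw [show 2 * n + 1 + 1 = 2 * (n + 1) by ring, pow_mul, hsq, pow_succ']
    · congr 1
      push_cast
      ring
  rw [(HasSum.even_add_odd (f := fun k : ℕ => √x ^ (k + 1) / Gamma (((k : ℝ) + 1) / 2))
    heven hodd).tsum_eq, sqrt_div hx]
  ring
end

section
/- There exists a constant C > 0 such that for every real s ≥ 0, ∑_{k=1}^∞ s^k / √(k!) ≤ C (s + s² e^{s²/2}). -/
open Real

theorem sq_two_pow_mul_factorial_le (m : ℕ) :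
    (2 ^ m * m.factorial) ^ 2 ≤ (2 * m + 1).factorial := by
  induction m with
  | zero => simp
  | succ m ih =>
    have h : (2 * (m + 1) + 1).factorial = (2 * m + 3) * ((2 * m + 2) * (2 * m + 1).factorial) := rfl
    rw [h, Nat.factorial_succ]
    calc (2 ^ (m + 1) * ((m + 1) * m.factorial)) ^ 2
        = (2 * m + 2) * ((2 * m + 2) * (2 ^ m * m.factorial) ^ 2) := by ring
      _ ≤ _ := by gcongr; omega

theorem pow_div_sqrt_factorial_le {s : ℝ} (hs : 0 ≤ s) (j : ℕ) {m n : ℕ} (hn : 2 * m + 1 ≤ n) :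
    s ^ (2 * m + j) / √(n.factorial) ≤ s ^ j * ((s ^ 2 / 2) ^ m / m.factorial) := by
  have hsqrt : (2 ^ m * m.factorial : ℝ) ≤ √(n.factorial) := by
    apply Real.le_sqrt_of_sq_le
    exact_mod_cast (sq_two_pow_mul_factorial_le m).trans (Nat.factorial_le hn)
  calc s ^ (2 * m + j) / √(n.factorial)
      ≤ s ^ (2 * m + j) / (2 ^ m * m.factorial) := by gcongr
    _ = s ^ j * ((s ^ 2 / 2) ^ m / m.factorial) := by
      rw [div_pow, pow_add, pow_mul]
      field_simp

/-- There is `C > 0` with `∑_{k=1}^∞ s^k/√(k!) ≤ C (s + s² e^{s²/2})` for all `s ≥ 0`. -/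
theorem tsum_pow_div_sqrt_factorial_le :
    ∃ C : ℝ, 0 < C ∧ ∀ s : ℝ, 0 ≤ s →
      ∑' k : ℕ, s ^ (k + 1) / Real.sqrt ((k + 1).factorial)
        ≤ C * (s + s ^ 2 * Real.exp (s ^ 2 / 2)) := by
  refine ⟨3, by norm_num, fun s hs => ?_⟩
  have hexp : HasSum (fun m : ℕ => (s ^ 2 / 2) ^ m / m.factorial) (exp (s ^ 2 / 2)) := by
    rw [Real.exp_eq_exp_ℝ]
    exact NormedSpace.expSeries_div_hasSum_exp _
  have hodd (m : ℕ) := pow_div_sqrt_factorial_le hs 1 (le_refl (2 * m + 1))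
  have heven (m : ℕ) := pow_div_sqrt_factorial_le hs 2 (Nat.le_succ (2 * m + 1))
  have sodd := Summable.of_nonneg_of_le (fun m => by positivity) hodd
    (hexp.mul_left (s ^ 1)).summable
  have seven := Summable.of_nonneg_of_le (fun m => by positivity) heven
    (hexp.mul_left (s ^ 2)).summable
  have hsplit := tsum_even_add_odd (f := fun k : ℕ => s ^ (k + 1) / √((k + 1).factorial))
    sodd seven
  have h₁ := hasSum_le hodd sodd.hasSum (hexp.mul_left (s ^ 1))
  have h₂ := hasSum_le heven seven.hasSum (hexp.mul_left (s ^ 2))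
  have hsum : ∑' k : ℕ, s ^ (k + 1) / √((k + 1).factorial)
      ≤ s ^ 1 * exp (s ^ 2 / 2) + s ^ 2 * exp (s ^ 2 / 2) :=
    hsplit.symm.le.trans (add_le_add h₁ h₂)
  have hpos := Real.exp_pos (s ^ 2 / 2)
  rcases le_total s 1 with h | h
  · have hle : exp (s ^ 2 / 2) ≤ 3 :=
      (exp_le_exp.2 (by nlinarith)).trans (exp_one_lt_d9.le.trans (by norm_num))
    nlinarith [mul_le_mul_of_nonneg_left hle hs, mul_nonneg (sq_nonneg s) hpos.le]
  · nlinarith [mul_nonneg (mul_nonneg hs (sub_nonneg.2 h)) hpos.le,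
      mul_nonneg (sq_nonneg s) hpos.le]
end

section
/- Let a_{kl} = ∫_{ℝ²} 1_{{x ≤ y}} H_k(x) H_l(y) φ(x) φ(y) dx dy for k, l ≥ 0. Then a_{00} = 1/2; a_{kl} = 0 whenever k + l is even and k + l ≥ 2; and a_{kl} = ((−1)^{(l+3k−1)/2} / (2π)) · Γ((k+l)/2) whenever k + l is odd. -/
open MeasureTheory Real

/-- Standard normal density `φ(x) = (2π)^{-1/2} e^{-x²/2}`. -/
noncomputable def stdNormalDensity (x : ℝ) : ℝ :=
  (Real.sqrt (2 * Real.pi))⁻¹ * Real.exp (-x ^ 2 / 2)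

/-- Hermite coefficients of the Wilcoxon kernel `h(x,y) = 1_{x ≤ y}`:
`a_{kl} = ∫ 1_{x ≤ y} H_k(x) H_l(y) φ(x) φ(y) dx dy`. -/
noncomputable def wilcoxonCoeff (k l : ℕ) : ℝ :=
  ∫ q : ℝ × ℝ, (if q.1 ≤ q.2 then (1 : ℝ) else 0) * hermiteFun k q.1 * hermiteFun l q.2 *
    stdNormalDensity q.1 * stdNormalDensity q.2

open Set Filter Topology

theorem integrable_aeval_mul_exp_neg_mul_sq {b : ℝ} (hb : 0 < b) (p : Polynomial ℤ) :
    Integrable fun x : ℝ => Polynomial.aeval x p * exp (-b * x ^ 2) := by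
  induction p using Polynomial.induction_on' with
  | add p q hp hq => simpa only [map_add, add_mul] using! hp.add hq
  | monomial n a =>
    have h := integrable_rpow_mul_exp_neg_mul_sq hb (s := n)
      (by linarith [(Nat.cast_nonneg n : (0 : ℝ) ≤ n)])
    simp only [rpow_natCast] at h
    simpa [Polynomial.aeval_monomial, mul_assoc] using h.const_mul (a : ℝ)

theorem derivative_hermite_succ (n : ℕ) :
    Polynomial.derivative (Polynomial.hermite (n + 1)) =
      ((n : Polynomial ℤ) + 1) * Polynomial.hermite n := by
  induction n with
  | zero => simp
  | succ n ih =>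
    rw [Polynomial.hermite_succ (n + 1), ih]
    simp only [Polynomial.derivative_sub, Polynomial.derivative_mul, Polynomial.derivative_X,
      Polynomial.derivative_add, Polynomial.derivative_natCast, Polynomial.derivative_one]
    push_cast
    linear_combination Polynomial.X * ih - ((n : Polynomial ℤ) + 1) * Polynomial.hermite_succ n

theorem hermiteFun_succ_succ (n : ℕ) (x : ℝ) :
    hermiteFun (n + 2) x = x * hermiteFun (n + 1) x - (n + 1) * hermiteFun n x := by
  rw [hermiteFun, Polynomial.hermite_succ, derivative_hermite_succ]
  simp [hermiteFun]

/-- The Hermite function `H_k φ`. -/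
noncomputable def hermiteDensity (k : ℕ) (x : ℝ) : ℝ := hermiteFun k x * stdNormalDensity x

theorem hasDerivAt_hermiteDensity (k : ℕ) (x : ℝ) :
    HasDerivAt (hermiteDensity k) (-hermiteDensity (k + 1) x) x := by
  have hφ : HasDerivAt stdNormalDensity (-x * stdNormalDensity x) x := by
    have h : HasDerivAt (fun y : ℝ => -y ^ 2 / 2) (-x) x := by
      convert! ((hasDerivAt_pow 2 x).neg.div_const 2) using 1
      simp only [Nat.cast_ofNat, Nat.add_one_sub_one, pow_one]
      ring
    convert! h.exp.const_mul (√(2 * π))⁻¹ using 1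
    simp only [stdNormalDensity]
    ring
  have hH : HasDerivAt (hermiteFun k)
      (Polynomial.aeval x (Polynomial.derivative (Polynomial.hermite k))) x :=
    Polynomial.hasDerivAt_aeval _ x
  convert! hH.mul hφ using 1
  simp only [hermiteDensity, hermiteFun, Polynomial.hermite_succ, map_sub, map_mul,
    Polynomial.aeval_X]
  ring

theorem continuous_hermiteDensity (k : ℕ) : Continuous (hermiteDensity k) :=
  continuous_iff_continuousAt.2 fun x => (hasDerivAt_hermiteDensity k x).continuousAt

theorem integrable_hermiteDensity (k : ℕ) : Integrable (hermiteDensity k) := by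
  convert! (integrable_aeval_mul_exp_neg_mul_sq one_half_pos
    (Polynomial.hermite k)).const_mul (√(2 * π))⁻¹ using 2 with x
  simp only [hermiteDensity, hermiteFun, stdNormalDensity]
  ring_nf

theorem hermiteDensity_mul (k l : ℕ) (x : ℝ) :
    hermiteDensity k x * hermiteDensity l x =
      (2 * π)⁻¹ * (Polynomial.aeval x (Polynomial.hermite k * Polynomial.hermite l) *
        exp (-1 * x ^ 2)) := by
  have h1 : (√(2 * π))⁻¹ * (√(2 * π))⁻¹ = (2 * π)⁻¹ := by
    rw [← mul_inv, mul_self_sqrt (by positivity)]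
  have h2 : exp (-x ^ 2 / 2) * exp (-x ^ 2 / 2) = exp (-1 * x ^ 2) := by
    rw [← exp_add]
    ring_nf
  rw [← h1, ← h2, map_mul]
  simp only [hermiteDensity, hermiteFun, stdNormalDensity]
  ring

theorem integrable_hermiteDensity_mul (k l : ℕ) :
    Integrable fun x => hermiteDensity k x * hermiteDensity l x := by
  simp only [hermiteDensity_mul]
  exact (integrable_aeval_mul_exp_neg_mul_sq one_pos _).const_mul _

theorem integral_Ioi_hermiteDensity_succ (k : ℕ) (a : ℝ) :
    ∫ x in Ioi a, hermiteDensity (k + 1) x = hermiteDensity k a := by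
  have hd := (integrable_hermiteDensity (k + 1)).neg.integrableOn (s := Ioi a)
  have h := integral_Ioi_of_hasDerivAt_of_tendsto'
    (fun x _ => hasDerivAt_hermiteDensity k x) hd
    (tendsto_zero_of_hasDerivAt_of_integrableOn_Ioi (a := a)
      (fun x _ => hasDerivAt_hermiteDensity k x) hd (integrable_hermiteDensity k).integrableOn)
  rw [integral_neg] at h
  linarith

theorem integral_Iic_hermiteDensity_succ (k : ℕ) (a : ℝ) :
    ∫ x in Iic a, hermiteDensity (k + 1) x = -hermiteDensity k a := by
  have hd := (integrable_hermiteDensity (k + 1)).neg.integrableOn (s := Iic a)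
  have h := integral_Iic_of_hasDerivAt_of_tendsto'
    (fun x _ => hasDerivAt_hermiteDensity k x) hd
    (tendsto_zero_of_hasDerivAt_of_integrableOn_Iic (a := a)
      (fun x _ => hasDerivAt_hermiteDensity k x) hd (integrable_hermiteDensity k).integrableOn)
  rw [integral_neg] at h
  linarith

theorem integral_hermiteDensity_zero : ∫ x, hermiteDensity 0 x = 1 := by
  have h := integral_gaussian (1 / 2)
  have e : ∀ x, hermiteDensity 0 x = (√(2 * π))⁻¹ * exp (-(1 / 2) * x ^ 2) := fun x => by
    simp only [hermiteDensity, hermiteFun, stdNormalDensity, Polynomial.hermite_zero, map_one]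
    ring_nf
  simp only [e]
  rw [integral_const_mul, h, show π / (1 / 2) = 2 * π by ring]
  exact inv_mul_cancel₀ (by positivity)

theorem integrable_indicator_le_mul_hermiteDensity (k l : ℕ) :
    Integrable ({q : ℝ × ℝ | q.1 ≤ q.2}.indicator
      fun q => hermiteDensity k q.1 * hermiteDensity l q.2) (volume.prod volume) :=
  ((integrable_hermiteDensity k).mul_prod (integrable_hermiteDensity l)).indicator
    (measurableSet_le measurable_fst measurable_snd)

theorem wilcoxonCoeff_eq_integral_indicator (k l : ℕ) :
    wilcoxonCoeff k l = ∫ q, {q : ℝ × ℝ | q.1 ≤ q.2}.indicator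
      (fun q => hermiteDensity k q.1 * hermiteDensity l q.2) q ∂volume.prod volume := by
  rw [wilcoxonCoeff, Measure.volume_eq_prod]
  congr 1 with q
  by_cases h : q.1 ≤ q.2
  · simp [h, hermiteDensity]
    ring
  · simp [h]

theorem wilcoxonCoeff_eq_integral_Ioi (k l : ℕ) :
    wilcoxonCoeff k l = ∫ x, hermiteDensity k x * ∫ y in Ioi x, hermiteDensity l y := by
  rw [wilcoxonCoeff_eq_integral_indicator,
    integral_prod _ (integrable_indicator_le_mul_hermiteDensity k l)]
  congr 1 with x
  rw [← integral_Ici_eq_integral_Ioi, ← integral_const_mul,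
    ← integral_indicator measurableSet_Ici]
  rfl

theorem wilcoxonCoeff_eq_integral_Iic (k l : ℕ) :
    wilcoxonCoeff k l = ∫ y, hermiteDensity l y * ∫ x in Iic y, hermiteDensity k x := by
  rw [wilcoxonCoeff_eq_integral_indicator,
    integral_prod_symm _ (integrable_indicator_le_mul_hermiteDensity k l)]
  congr 1 with y
  rw [mul_comm, ← integral_mul_const, ← integral_indicator measurableSet_Iic]
  rfl

theorem wilcoxonCoeff_zero_zero : wilcoxonCoeff 0 0 = 1 / 2 := by
  have hsplit (x : ℝ) : ∫ y in Ioi x, hermiteDensity 0 y =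
      1 - ∫ y in Iic x, hermiteDensity 0 y := by
    rw [← integral_hermiteDensity_zero,
      ← intervalIntegral.integral_Iic_add_Ioi (b := x)
        (integrable_hermiteDensity 0).integrableOn (integrable_hermiteDensity 0).integrableOn]
    ring
  have hint : Integrable fun y => hermiteDensity 0 y * ∫ x in Iic y, hermiteDensity 0 x := by
    have h := (integrable_indicator_le_mul_hermiteDensity 0 0).integral_prod_right
    convert! h using 2 with y
    rw [mul_comm, ← integral_mul_const, ← integral_indicator measurableSet_Iic]
    rfl
  have h1 := wilcoxonCoeff_eq_integral_Ioi 0 0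
  simp only [hsplit, mul_sub, mul_one] at h1
  rw [integral_sub (integrable_hermiteDensity 0) hint, integral_hermiteDensity_zero,
    ← wilcoxonCoeff_eq_integral_Iic] at h1
  linarith

/-- The pairing `∫ H_k H_l φ²`. -/
noncomputable def hermiteDensityPairing (k l : ℕ) : ℝ :=
  ∫ x, hermiteDensity k x * hermiteDensity l x

theorem hermiteDensityPairing_comm (k l : ℕ) :
    hermiteDensityPairing k l = hermiteDensityPairing l k := by
  simp only [hermiteDensityPairing, mul_comm]

theorem hermiteDensityPairing_succ_right (k l : ℕ) :
    hermiteDensityPairing k (l + 1) = -hermiteDensityPairing (k + 1) l := by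
  have hi := (integrable_hermiteDensity_mul (k + 1) l).add
    (integrable_hermiteDensity_mul k (l + 1))
  have h := integral_eq_zero_of_hasDerivAt_of_integrable
    (f := fun x => hermiteDensity k x * hermiteDensity l x)
    (f' := fun x => -(hermiteDensity (k + 1) x * hermiteDensity l x +
      hermiteDensity k x * hermiteDensity (l + 1) x))
    (fun x => by
      convert! (hasDerivAt_hermiteDensity k x).mul (hasDerivAt_hermiteDensity l x) using 1
      ring)
    hi.neg (integrable_hermiteDensity_mul k l)
  rw [integral_neg, integral_add (integrable_hermiteDensity_mul (k + 1) l)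
    (integrable_hermiteDensity_mul k (l + 1))] at h
  simp only [hermiteDensityPairing]
  linarith

theorem hermiteDensityPairing_eq (k l : ℕ) :
    hermiteDensityPairing k l = (-1) ^ l * hermiteDensityPairing (k + l) 0 := by
  induction l generalizing k with
  | zero => simp
  | succ l ih =>
    rw [hermiteDensityPairing_succ_right, ih, pow_succ, add_right_comm, add_assoc]
    ring

theorem hermiteDensityPairing_succ_succ_zero (n : ℕ) :
    hermiteDensityPairing (n + 2) 0 = -((n + 1) / 2) * hermiteDensityPairing n 0 := by
  have e (x : ℝ) : hermiteDensity (n + 2) x * hermiteDensity 0 x =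
      hermiteDensity (n + 1) x * hermiteDensity 1 x -
        (n + 1) * (hermiteDensity n x * hermiteDensity 0 x) := by
    simp only [hermiteDensity, hermiteFun_succ_succ]
    simp only [hermiteFun, Polynomial.hermite_zero, Polynomial.hermite_one, map_one,
      Polynomial.aeval_X]
    ring
  have h : hermiteDensityPairing (n + 2) 0 =
      hermiteDensityPairing (n + 1) 1 - (n + 1) * hermiteDensityPairing n 0 := by
    simp only [hermiteDensityPairing, e]
    rw [integral_sub (integrable_hermiteDensity_mul _ _)
      ((integrable_hermiteDensity_mul _ _).const_mul _), integral_const_mul]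
  have h' := hermiteDensityPairing_succ_right (n + 1) 0
  rw [zero_add] at h'
  rw [h'] at h
  linarith

theorem hermiteDensityPairing_odd_zero (p : ℕ) : hermiteDensityPairing (2 * p + 1) 0 = 0 := by
  induction p with
  | zero =>
    have h := hermiteDensityPairing_succ_right 0 0
    rw [hermiteDensityPairing_comm 0] at h
    simp only [zero_add, mul_zero] at h ⊢
    linarith
  | succ p ih =>
    rw [show 2 * (p + 1) + 1 = 2 * p + 1 + 2 by ring, hermiteDensityPairing_succ_succ_zero, ih,
      mul_zero]

theorem hermiteDensityPairing_even_zero (p : ℕ) :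
    hermiteDensityPairing (2 * p) 0 = (-1) ^ p / (2 * π) * Gamma (p + 1 / 2) := by
  induction p with
  | zero =>
    have h := integral_gaussian 1
    simp only [mul_zero, hermiteDensityPairing, hermiteDensity_mul, Polynomial.hermite_zero,
      map_one, mul_one, one_mul]
    rw [integral_const_mul, h, Nat.cast_zero, zero_add, Gamma_one_half_eq]
    simp
  | succ p ih =>
    rw [show 2 * (p + 1) = 2 * p + 2 by ring, hermiteDensityPairing_succ_succ_zero, ih,
      show ((p + 1 : ℕ) : ℝ) + 1 / 2 = (p + 1 / 2) + 1 by push_cast; ring,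
      Gamma_add_one (by positivity)]
    push_cast
    ring

theorem wilcoxonCoeff_succ_right (k l : ℕ) :
    wilcoxonCoeff k (l + 1) = hermiteDensityPairing k l := by
  simp only [wilcoxonCoeff_eq_integral_Ioi, integral_Ioi_hermiteDensity_succ,
    hermiteDensityPairing]

theorem wilcoxonCoeff_succ_left (k l : ℕ) :
    wilcoxonCoeff (k + 1) l = -hermiteDensityPairing k l := by
  simp only [wilcoxonCoeff_eq_integral_Iic, integral_Iic_hermiteDensity_succ,
    hermiteDensityPairing, mul_neg, integral_neg, mul_comm]

theorem wilcoxonCoeff_eq_pairing {k l n : ℕ} (h : k + l = n + 1) :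
    wilcoxonCoeff k l = -(-1) ^ l * hermiteDensityPairing n 0 := by
  cases l with
  | zero =>
    obtain rfl : k = n + 1 := h
    rw [wilcoxonCoeff_succ_left]
    simp
  | succ l =>
    obtain rfl : k + l = n := by omega
    rw [wilcoxonCoeff_succ_right, hermiteDensityPairing_eq, pow_succ]
    ring

theorem wilcoxonCoeff_formula :
    wilcoxonCoeff 0 0 = 1 / 2 ∧
    (∀ k l : ℕ, Even (k + l) → 2 ≤ k + l → wilcoxonCoeff k l = 0) ∧
    (∀ k l : ℕ, Odd (k + l) →
      wilcoxonCoeff k l =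
        (-1 : ℝ) ^ ((l + 3 * k - 1) / 2) / (2 * Real.pi) *
          Real.Gamma (((k : ℝ) + l) / 2)) := by
  refine ⟨wilcoxonCoeff_zero_zero, fun k l he h2 => ?_, fun k l ⟨p, hp⟩ => ?_⟩
  · obtain ⟨m, hm⟩ := he
    obtain ⟨p, rfl⟩ : ∃ p, m = p + 1 := ⟨m - 1, by omega⟩
    rw [wilcoxonCoeff_eq_pairing (n := 2 * p + 1) (by omega), hermiteDensityPairing_odd_zero,
      mul_zero]
  · have hexp : (l + 3 * k - 1) / 2 = p + k := by omega
    have hcast : ((k : ℝ) + l) / 2 = p + 1 / 2 := by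
      have h : (k : ℝ) + l = 2 * p + 1 := mod_cast hp
      rw [h]
      ring
    have hsign : -(-1 : ℝ) ^ l = (-1) ^ k := by
      have h : (-1 : ℝ) ^ k * (-1) ^ l = -1 := by
        rw [← pow_add, hp, Odd.neg_one_pow ⟨p, rfl⟩]
      rcases neg_one_pow_eq_or ℝ l with hl | hl <;> rw [hl] at h ⊢ <;> linarith
    rw [wilcoxonCoeff_eq_pairing hp, hermiteDensityPairing_even_zero, hexp, hcast, hsign, pow_add]
    ring
end
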